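/- Let ε = 𝒦 − cl H = {k − h : k ∈ 𝒦, h ∈ cl H} be the extended image (Minkowski difference of 𝒦 and the closure of H). Then the following three statements are equivalent: (1) y is an efficient solution, i.e. F(x) ∉ C \ {0} for every x ∈ K; (2) H ∩ ε = ∅; (3) H ∩ 𝒦 = ∅. -/

import Mathlib

/-- Theorem 3.1 (equivalence between efficiency and disjunction in the image space,
including the extended image ε = 𝒦 − cl H). -/
theorem extended_image_equivalence
    {E : Type*} [NormedAddCommGroup E] [InnerProductSpace ℝ E] [FiniteDimensional ℝ E]
    (C : Set E)
    (hCadd : ∀ a ∈ C, ∀ b ∈ C, a + b ∈ C)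
    (hCsmul : ∀ t : ℝ, 0 ≤ t → ∀ a ∈ C, t • a ∈ C)
    (hCclosed : IsClosed C)
    (hCpointed : C ∩ (-C) = {0})
    (hCint : (interior C).Nonempty)
    (l : ℕ) (hl : 0 < l)
    {M : Type*} [Nonempty M]
    (F : M → E) (g : M → EuclideanSpace ℝ (Fin l))
    (K : Set M) (hK : K = {x | ∀ i, 0 ≤ g x i})
    (y : M) (hy : y ∈ K) (hFy : F y = 0)
    (H : Set (E × EuclideanSpace ℝ (Fin l)))
    (hH : H = {p | p.1 ∈ C \ {0} ∧ ∀ i, 0 ≤ p.2 i})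
    (𝒦 : Set (E × EuclideanSpace ℝ (Fin l)))
    (h𝒦 : 𝒦 = {p | ∃ x : M, p = (F x, g x)})
    (ε : Set (E × EuclideanSpace ℝ (Fin l)))
    (hε : ε = {p | ∃ k ∈ 𝒦, ∃ h ∈ closure H, p = k - h}) :
    ((∀ x ∈ K, F x ∉ C \ {0}) ↔ H ∩ ε = ∅) ∧
    ((H ∩ ε = ∅) ↔ H ∩ 𝒦 = ∅) := by
  have hHmem : ∀ p, p ∈ H ↔ (p.1 ∈ C ∧ p.1 ≠ 0) ∧ ∀ i, 0 ≤ p.2 i := by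
    intro p
    simp [hH]
  have hclosure : ∀ p ∈ closure H, p.1 ∈ C ∧ ∀ i, 0 ≤ p.2 i := by
    have hclosed : IsClosed {p : E × EuclideanSpace ℝ (Fin l) | p.1 ∈ C ∧ ∀ i, 0 ≤ p.2 i} := by
      have horthant : IsClosed {p : E × EuclideanSpace ℝ (Fin l) | ∀ i, 0 ≤ p.2 i} := by
        rw [Set.ofPred_forall]
        exact isClosed_iInter fun i => isClosed_le continuous_const (by fun_prop)
      exact (hCclosed.preimage continuous_fst).inter horthant
    have hsub : H ⊆ {p : E × EuclideanSpace ℝ (Fin l) | p.1 ∈ C ∧ ∀ i, 0 ≤ p.2 i} :=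
      fun q hq => ⟨((hHmem q).1 hq).1.1, ((hHmem q).1 hq).2⟩
    exact fun p hp => closure_minimal hsub hclosed hp
  have hadd : ∀ p ∈ H, ∀ q ∈ closure H, p + q ∈ H := by
    intro p hp q hq
    obtain ⟨⟨hpC, hp0⟩, hp2⟩ := (hHmem p).1 hp
    obtain ⟨hqC, hq2⟩ := hclosure q hq
    refine (hHmem _).2 ⟨⟨hCadd _ hpC _ hqC, fun h0 => hp0 ?_⟩, fun i => add_nonneg (hp2 i) (hq2 i)⟩
    have hneg : -p.1 = q.1 := neg_eq_of_add_eq_zero_right h0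
    have hmem : p.1 ∈ C ∩ (-C) := ⟨hpC, by rw [Set.mem_neg, hneg]; exact hqC⟩
    rwa [hCpointed] at hmem
  have hhalf : ∀ p ∈ H, (2⁻¹ : ℝ) • p ∈ H := by
    intro p hp
    obtain ⟨⟨hpC, hp0⟩, hp2⟩ := (hHmem p).1 hp
    exact (hHmem _).2 ⟨⟨hCsmul _ (by norm_num) _ hpC, smul_ne_zero (by norm_num) hp0⟩,
      fun i => mul_nonneg (by norm_num) (hp2 i)⟩
  have hextended : H ∩ ε = ∅ ↔ H ∩ 𝒦 = ∅ := by
    simp only [Set.eq_empty_iff_forall_notMem]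
    constructor
    · rintro h p ⟨hpH, hpK⟩
      refine h ((2⁻¹ : ℝ) • p) ⟨hhalf p hpH, ?_⟩
      rw [hε]
      exact ⟨p, hpK, (2⁻¹ : ℝ) • p, subset_closure (hhalf p hpH), by module⟩
    · rintro h p ⟨hpH, hpε⟩
      rw [hε] at hpε
      obtain ⟨k, hk, q, hq, rfl⟩ := hpε
      exact h k ⟨by simpa using hadd _ hpH q hq, hk⟩
  have hefficient : (∀ x ∈ K, F x ∉ C \ {0}) ↔ H ∩ 𝒦 = ∅ := by
    subst hK hH h𝒦
    rw [Set.eq_empty_iff_forall_notMem]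
    constructor
    · rintro h p ⟨⟨hp1, hp2⟩, x, rfl⟩
      exact h x hp2 hp1
    · exact fun h x hx hFx => h (F x, g x) ⟨⟨hFx, hx⟩, x, rfl⟩
  exact ⟨hefficient.trans hextended.symm, hextended⟩
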